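/- arXiv:0905.3036 — 2 statements merged into one kernel-verified Lean document; each statement's English description precedes it below -/
import Mathlib

section
/- Let 1 < p < ∞ and m ≥ 1. There exists a positive constant C = C(m,p) such that for all M ∈ ℝ and all real scalars (a_i)_{i=1}^m with |a_1| ≥ C·Σ_{j=2}^m |a_j|, one has ‖M + Σ_{i=1}^m a_i h_i^{(p)}‖_{L_p[0,1]} ≥ ‖M + Σ_{i=2}^m a_i h_i^{(p)}‖_{L_p[0,1]}. -/
open MeasureTheory

/-- The Haar functions on `[0,1]` (extended by `0` to all of `ℝ`): `haarFn 0` is the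
indicator of `[0,1)` (i.e. `h₀ ≡ 1` on `[0,1]` up to the single point `1`), and for
`i = 2^n + k` with `0 ≤ k < 2^n` (so that `n = Nat.log 2 i`), `haarFn i` is `1` on
`[k/2^n, (2k+1)/2^(n+1))`, `-1` on `[(2k+1)/2^(n+1), (k+1)/2^n)` and `0` elsewhere. -/
noncomputable def haarFn (i : ℕ) : ℝ → ℝ :=
  if i = 0 then Set.indicator (Set.Ico (0 : ℝ) 1) 1
  else
    let n := Nat.log 2 i
    let k := i - 2 ^ n
    fun t =>
      Set.indicator (Set.Ico ((k : ℝ) / 2 ^ n) ((2 * (k : ℝ) + 1) / 2 ^ (n + 1))) 1 t -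
        Set.indicator (Set.Ico ((2 * (k : ℝ) + 1) / 2 ^ (n + 1)) (((k : ℝ) + 1) / 2 ^ n)) 1 t

/-- The `L_p[0,1]` norm of a function `f : ℝ → ℝ`. -/
noncomputable def pnorm (p : ℝ) (f : ℝ → ℝ) : ℝ :=
  (eLpNorm f (ENNReal.ofReal p) (volume.restrict (Set.Ico (0 : ℝ) 1))).toReal

/-- The `L_p`-normalized Haar function `h_i^{(p)} = h_i / ‖h_i‖_p`. -/
noncomputable def haarFnP (p : ℝ) (i : ℕ) : ℝ → ℝ :=
  fun t => haarFn i t / pnorm p (haarFn i)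

/-- The norming functional of a nonzero `y ∈ L_p[0,1]` applied to `g`:
`F_y(g) = ‖y‖_p^{1−p} ∫₀¹ sign(y(t)) |y(t)|^{p−1} g(t) dt`. -/
noncomputable def normingF (p : ℝ) (y g : ℝ → ℝ) : ℝ :=
  pnorm p y ^ (1 - p) *
    ∫ t in Set.Ico (0 : ℝ) 1, Real.sign (y t) * |y t| ^ (p - 1) * g t

/-- Spreading two points apart by a shift that exceeds their distance increases the sum of the
values of a convex function. -/
lemma ConvexOn.add_le_add_shift {g : ℝ → ℝ} (hg : ConvexOn ℝ Set.univ g) {x y a : ℝ}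
    (h : |x - y| ≤ |a|) : g x + g y ≤ g (x + a) + g (y - a) := by
  have key : ∀ {x y a : ℝ}, 0 < a → |x - y| ≤ a → g x + g y ≤ g (x + a) + g (y - a) := by
    intro x y a ha h
    obtain ⟨h₁, h₂⟩ := abs_le.mp h
    have hL : 0 < x - y + 2 * a := by linarith
    set l := (x - y + a) / (x - y + 2 * a) with hl
    have hl0 : 0 ≤ l := div_nonneg (by linarith) hL.le
    have hl1 : 0 ≤ 1 - l := by
      rw [sub_nonneg, hl, div_le_one hL]
      linarith
    have hx := hg.2 (Set.mem_univ (x + a)) (Set.mem_univ (y - a)) hl0 hl1 (by ring)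
    have hy := hg.2 (Set.mem_univ (x + a)) (Set.mem_univ (y - a)) hl1 hl0 (by ring)
    have hlL : l * (x - y + 2 * a) = x - y + a := by
      rw [hl, div_mul_cancel₀ _ hL.ne']
    simp only [smul_eq_mul] at hx hy
    rw [show l * (x + a) + (1 - l) * (y - a) = x by linear_combination hlL] at hx
    rw [show (1 - l) * (x + a) + l * (y - a) = y by linear_combination -hlL] at hy
    linarith
  rcases lt_trichotomy a 0 with ha | rfl | ha
  · have := @key y x (-a) (by linarith) (by rwa [abs_sub_comm, ← abs_of_neg ha])
    rw [sub_neg_eq_add, ← sub_eq_add_neg] at this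
    linarith
  · simp
  · exact key ha (by rwa [abs_of_pos ha] at h)

lemma convexOn_abs_rpow {p : ℝ} (hp : 1 ≤ p) :
    ConvexOn ℝ Set.univ (fun x : ℝ => |x| ^ p) := by
  refine ⟨convex_univ, fun x _ y _ s t hs ht hst => ?_⟩
  refine le_trans ?_ ((convexOn_rpow hp).2 (abs_nonneg x) (abs_nonneg y) hs ht hst)
  refine Real.rpow_le_rpow (abs_nonneg _) ?_ (by linarith)
  simpa [abs_mul, abs_of_nonneg hs, abs_of_nonneg ht] using abs_add_le (s * x) (t * y)

lemma setLIntegral_Ico_zero_one_eq_half {G : ℝ → ENNReal} (hG : Measurable G) :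
    ∫⁻ t in Set.Ico (0 : ℝ) 1, G t = ∫⁻ t in Set.Ico (0 : ℝ) (1 / 2), (G t + G (t + 1 / 2)) := by
  have hpre : (fun t : ℝ => t + 1 / 2) ⁻¹' Set.Ico (1 / 2) 1 = Set.Ico 0 (1 / 2) := by
    rw [Set.preimage_add_const_Ico]
    norm_num
  rw [lintegral_add_left hG, ← Set.Ico_union_Ico_eq_Ico (by norm_num : (0 : ℝ) ≤ 1 / 2)
    (by norm_num : (1 / 2 : ℝ) ≤ 1), lintegral_union measurableSet_Ico (by simp),
    ← (measurePreserving_add_right volume (1 / 2 : ℝ)).setLIntegral_comp_preimage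
      (s := Set.Ico (1 / 2) 1) measurableSet_Ico hG, hpre]

lemma measurable_haarFn (i : ℕ) : Measurable (haarFn i) := by
  unfold haarFn
  split_ifs
  · exact measurable_one.indicator measurableSet_Ico
  · exact (measurable_one.indicator measurableSet_Ico).sub
      (measurable_one.indicator measurableSet_Ico)

lemma abs_haarFn_le_one (i : ℕ) (t : ℝ) : |haarFn i t| ≤ 1 := by
  unfold haarFn
  split_ifs
  · simp only [Set.indicator_apply]
    split_ifs <;> simp
  · simp only [Set.indicator_apply]
    split_ifs <;> simp

lemma haarFn_one_left {t : ℝ} (ht : t ∈ Set.Ico (0 : ℝ) (1 / 2)) : haarFn 1 t = 1 := by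
  obtain ⟨h₀, h₁⟩ := ht
  rw [one_div] at h₁
  simp [haarFn, Set.indicator_apply, h₀, h₁, not_le.2]

lemma haarFn_one_right {t : ℝ} (ht : t ∈ Set.Ico (1 / 2 : ℝ) 1) : haarFn 1 t = -1 := by
  obtain ⟨h₀, h₁⟩ := ht
  rw [one_div] at h₀
  simp [haarFn, Set.indicator_apply, h₀, h₁, not_lt.2]

lemma pnorm_haarFn_one {p : ℝ} (hp : 0 < p) : pnorm p (haarFn 1) = 1 := by
  have h : eLpNorm (haarFn 1) (ENNReal.ofReal p) (volume.restrict (Set.Ico (0 : ℝ) 1)) =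
      eLpNorm (fun _ : ℝ => (1 : ℝ)) (ENNReal.ofReal p)
        (volume.restrict (Set.Ico (0 : ℝ) 1)) := by
    refine eLpNorm_congr_norm_ae ((ae_restrict_iff' measurableSet_Ico).2 (.of_forall ?_))
    intro t ht
    rcases lt_or_ge t (1 / 2) with h | h
    · simp [haarFn_one_left ⟨ht.1, h⟩]
    · simp [haarFn_one_right ⟨h, ht.2⟩]
  rw [pnorm, h, eLpNorm_const' _ (by simpa using hp) ENNReal.ofReal_ne_top]
  simp

lemma haarFnP_one {p : ℝ} (hp : 0 < p) : haarFnP p 1 = haarFn 1 := by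
  funext t
  rw [haarFnP, pnorm_haarFn_one hp, div_one]

lemma abs_haarFnP_le (p : ℝ) (i : ℕ) (t : ℝ) : |haarFnP p i t| ≤ |(pnorm p (haarFn i))⁻¹| := by
  rw [haarFnP, div_eq_mul_inv, abs_mul]
  exact mul_le_of_le_one_left (abs_nonneg _) (abs_haarFn_le_one i t)

lemma measurable_haarFnP (p : ℝ) (i : ℕ) : Measurable (haarFnP p i) :=
  (measurable_haarFn i).div_const _

/-- Adding a multiple `a` of the first Haar function to a bounded function does not decrease the
`L_p` norm if the function oscillates by at most `|a|`. -/
lemma pnorm_le_pnorm_add_haarFn_one {p : ℝ} (hp : 1 ≤ p) {f : ℝ → ℝ} (hf : Measurable f) {B : ℝ}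
    (hB : ∀ t, |f t| ≤ B) {a : ℝ} (ha : ∀ s t, |f s - f t| ≤ |a|) :
    pnorm p f ≤ pnorm p (fun t => f t + a * haarFn 1 t) := by
  have hp0 : 0 < p := by linarith
  have hm : Measurable (fun t => f t + a * haarFn 1 t) :=
    hf.add ((measurable_haarFn 1).const_mul a)
  have hfin : MemLp (fun t => f t + a * haarFn 1 t) (ENNReal.ofReal p)
      (volume.restrict (Set.Ico (0 : ℝ) 1)) := by
    refine MemLp.of_bound hm.aestronglyMeasurable (B + |a|) (.of_forall fun t => ?_)
    rw [Real.norm_eq_abs]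
    refine (abs_add_le _ _).trans (add_le_add (hB t) ?_)
    rw [abs_mul]
    exact mul_le_of_le_one_right (abs_nonneg _) (abs_haarFn_le_one 1 t)
  have henorm : ∀ x : ℝ, ‖x‖ₑ ^ p = ENNReal.ofReal (|x| ^ p) := fun x => by
    rw [Real.enorm_eq_ofReal_abs, ENNReal.ofReal_rpow_of_nonneg (abs_nonneg _) hp0.le]
  refine ENNReal.toReal_mono hfin.eLpNorm_ne_top ?_
  have hne : ENNReal.ofReal p ≠ 0 := by simpa using hp0
  rw [eLpNorm_eq_lintegral_rpow_enorm_toReal hne ENNReal.ofReal_ne_top,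
    eLpNorm_eq_lintegral_rpow_enorm_toReal hne ENNReal.ofReal_ne_top, ENNReal.toReal_ofReal hp0.le]
  refine ENNReal.rpow_le_rpow ?_ (by positivity)
  rw [setLIntegral_Ico_zero_one_eq_half (hf.enorm.pow_const p),
    setLIntegral_Ico_zero_one_eq_half (hm.enorm.pow_const p)]
  refine setLIntegral_mono' measurableSet_Ico fun t ht => ?_
  have ht' : t + 1 / 2 ∈ Set.Ico (1 / 2 : ℝ) 1 := ⟨by linarith [ht.1], by linarith [ht.2]⟩
  simp only [henorm, haarFn_one_left ht, haarFn_one_right ht', mul_one, mul_neg, ← sub_eq_add_neg]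
  rw [← ENNReal.ofReal_add (by positivity) (by positivity),
    ← ENNReal.ofReal_add (by positivity) (by positivity)]
  exact ENNReal.ofReal_le_ofReal ((convexOn_abs_rpow hp).add_le_add_shift (ha _ _))

/-- for `1 < p < ∞` and `m ≥ 1` there is `C = C(m,p) > 0` such
that if `|a₁| ≥ C·Σ_{j=2}^m |a_j|` then
`‖M + Σ_{i=1}^m a_i h_i^{(p)}‖_p ≥ ‖M + Σ_{i=2}^m a_i h_i^{(p)}‖_p`. -/
theorem stmt_10 (p : ℝ) (hp : 1 < p) (m : ℕ) (hm : 1 ≤ m) :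
    ∃ C : ℝ, 0 < C ∧
      ∀ (M : ℝ) (a : ℕ → ℝ),
        C * (∑ j ∈ Finset.Icc 2 m, |a j|) ≤ |a 1| →
        pnorm p (fun t => M + ∑ i ∈ Finset.Icc 2 m, a i * haarFnP p i t) ≤
          pnorm p (fun t => M + ∑ i ∈ Finset.Icc 1 m, a i * haarFnP p i t) := by
  set K := ∑ i ∈ Finset.Icc 2 m, |(pnorm p (haarFn i))⁻¹|
  have hK0 : 0 ≤ K := Finset.sum_nonneg fun i _ => abs_nonneg _
  refine ⟨2 * K + 1, by linarith, fun M a h => ?_⟩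
  have hS0 : 0 ≤ ∑ j ∈ Finset.Icc 2 m, |a j| := Finset.sum_nonneg fun i _ => abs_nonneg _
  have hsum : ∀ t, |∑ i ∈ Finset.Icc 2 m, a i * haarFnP p i t| ≤
      K * ∑ j ∈ Finset.Icc 2 m, |a j| := fun t => by
    refine (Finset.abs_sum_le_sum_abs _ _).trans ?_
    rw [Finset.mul_sum]
    refine Finset.sum_le_sum fun i hi => ?_
    rw [abs_mul, mul_comm]
    refine mul_le_mul_of_nonneg_right ((abs_haarFnP_le p i t).trans ?_) (abs_nonneg _)
    exact Finset.single_le_sum (f := fun i => |(pnorm p (haarFn i))⁻¹|)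
      (fun i _ => abs_nonneg _) hi
  have hmeas : Measurable (fun t => M + ∑ i ∈ Finset.Icc 2 m, a i * haarFnP p i t) :=
    (Finset.measurable_fun_sum _ fun i _ => (measurable_haarFnP p i).const_mul (a i)).const_add M
  convert pnorm_le_pnorm_add_haarFn_one hp.le hmeas
    (fun t => (abs_add_le _ _).trans (add_le_add_right (hsum t) |M|)) (a := a 1) ?_ using 2
  · funext t
    rw [← Finset.add_sum_Ioc_eq_sum_Icc hm, haarFnP_one (by linarith),
      show Finset.Ioc 1 m = Finset.Icc 2 m from rfl]
    ring
  · intro s t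
    rw [add_sub_add_left_eq_sub]
    refine (abs_sub _ _).trans (le_trans ?_ h)
    linarith [hsum s, hsum t]
end

section
/- Let 1 < p ≤ 2. There exists a constant c > 0, depending only on p, such that for every m ≥ 1, every subset A ⊂ ℕ of cardinality m, every nonzero y in the linear span of {h_i^{(p)} : i ∈ A} in L_p[0,1], and every i_0 ∈ A maximizing |F_y(h_i^{(p)})| over i ∈ A, one has inf_{λ ∈ ℝ} ‖y − λ h_{i_0}^{(p)}‖_p ≤ (1 − c·m^{p/(2−2p)})·‖y‖_p. -/
open MeasureTheory

/-! ### Scalar inequalities -/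

theorem two_mul_mul_le_rpow_sub_rpow {a x : ℝ} (ha0 : 0 < a) (ha1 : a ≤ 1) (hx0 : 0 ≤ x)
    (hx1 : x ≤ 1) : 2 * a * x ≤ (1 + x) ^ a - (1 - x) ^ a := by
  have hmono : MonotoneOn (fun x : ℝ => (1 + x) ^ a - (1 - x) ^ a - 2 * a * x)
      (Set.Icc 0 1) := by
    apply monotoneOn_of_hasDerivWithinAt_nonneg (convex_Icc 0 1)
      (f' := fun x => a * (1 + x) ^ (a - 1) + a * (1 - x) ^ (a - 1) - 2 * a)
    · refine ContinuousOn.sub (ContinuousOn.sub ?_ ?_) (by fun_prop)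
      · exact ContinuousOn.rpow_const (by fun_prop) fun x hx => Or.inr ha0.le
      · exact ContinuousOn.rpow_const (by fun_prop) fun x hx => Or.inr ha0.le
    · intro x hx
      rw [interior_Icc] at hx
      have h1 : HasDerivAt (fun x : ℝ => (1 + x) ^ a) (1 * a * (1 + x) ^ (a - 1)) x :=
        ((hasDerivAt_id x).const_add 1).rpow_const (Or.inl (by simp; linarith [hx.1]))
      have h2 : HasDerivAt (fun x : ℝ => (1 - x) ^ a) (-1 * a * (1 - x) ^ (a - 1)) x :=
        ((hasDerivAt_id x).const_sub 1).rpow_const (Or.inl (by simp; linarith [hx.2]))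
      have h3 : HasDerivAt (fun x : ℝ => 2 * a * x) (2 * a * 1) x :=
        (hasDerivAt_id x).const_mul _
      exact (((h1.sub h2).sub h3).congr_deriv (by ring)).hasDerivWithinAt
    · intro x hx
      rw [interior_Icc] at hx
      have hA : 0 < (1 + x) ^ (a - 1) := Real.rpow_pos_of_pos (by linarith [hx.1]) _
      have hB : 0 < (1 - x) ^ (a - 1) := Real.rpow_pos_of_pos (by linarith [hx.2]) _
      have hAB : 1 ≤ (1 + x) ^ (a - 1) * (1 - x) ^ (a - 1) := by
        rw [← Real.mul_rpow (by linarith [hx.1]) (by linarith [hx.2])]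
        exact Real.one_le_rpow_of_pos_of_le_one_of_nonpos
          (mul_pos (by linarith [hx.1]) (by linarith [hx.2])) (by nlinarith [hx.1])
          (by linarith)
      have : 2 ≤ (1 + x) ^ (a - 1) + (1 - x) ^ (a - 1) := by
        nlinarith [sq_nonneg ((1 + x) ^ (a - 1) - (1 - x) ^ (a - 1))]
      nlinarith
  have := hmono (Set.left_mem_Icc.2 zero_le_one) (Set.mem_Icc.2 ⟨hx0, hx1⟩) hx0
  simp at this
  linarith

theorem one_add_sq_le_rpow_add_rpow {p x : ℝ} (hp1 : 1 < p) (hp2 : p ≤ 2) (hx0 : 0 ≤ x)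
    (hx1 : x ≤ 1) :
    1 + p * (p - 1) / 2 * x ^ 2 ≤ ((1 + x) ^ p + (1 - x) ^ p) / 2 := by
  have hmono : MonotoneOn
      (fun x : ℝ => (1 + x) ^ p + (1 - x) ^ p - p * (p - 1) * x ^ 2) (Set.Icc 0 1) := by
    apply monotoneOn_of_hasDerivWithinAt_nonneg (convex_Icc 0 1)
      (f' := fun x => p * ((1 + x) ^ (p - 1) - (1 - x) ^ (p - 1) - 2 * (p - 1) * x))
    · refine ContinuousOn.sub (ContinuousOn.add ?_ ?_) (by fun_prop)
      · exact ContinuousOn.rpow_const (by fun_prop) fun x hx => Or.inr (by linarith)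
      · exact ContinuousOn.rpow_const (by fun_prop) fun x hx => Or.inr (by linarith)
    · intro x hx
      have h1 : HasDerivAt (fun x : ℝ => (1 + x) ^ p) (1 * p * (1 + x) ^ (p - 1)) x :=
        ((hasDerivAt_id x).const_add 1).rpow_const (Or.inr hp1.le)
      have h2 : HasDerivAt (fun x : ℝ => (1 - x) ^ p) (-1 * p * (1 - x) ^ (p - 1)) x :=
        ((hasDerivAt_id x).const_sub 1).rpow_const (Or.inr hp1.le)
      have h3 : HasDerivAt (fun x : ℝ => p * (p - 1) * x ^ 2)
          (p * (p - 1) * (2 * x)) x := by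
        simpa using (hasDerivAt_pow 2 x).const_mul (p * (p - 1))
      exact (((h1.add h2).sub h3).congr_deriv (by ring)).hasDerivWithinAt
    · intro x hx
      rw [interior_Icc] at hx
      have := two_mul_mul_le_rpow_sub_rpow (a := p - 1) (by linarith) (by linarith)
        hx.1.le hx.2.le
      exact mul_nonneg (by linarith) (by linarith)
  have := hmono (Set.left_mem_Icc.2 zero_le_one) (Set.mem_Icc.2 ⟨hx0, hx1⟩) hx0
  simp at this
  linarith

/-- The two-point inequality for arguments ordered by size. -/
theorem two_point_of_abs_le {p s β : ℝ} (hp1 : 1 < p) (hp2 : p ≤ 2) (h : |β| ≤ |s|) :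
    (s ^ 2 + (p - 1) * β ^ 2) ^ (p / 2) ≤ (|s + β| ^ p + |s - β| ^ p) / 2 := by
  rcases eq_or_ne s 0 with rfl | hs
  · have : β = 0 := by simpa using h
    subst this
    simp [Real.zero_rpow (show p ≠ 0 by linarith), Real.zero_rpow (show p / 2 ≠ 0 by linarith)]
  have hs' : 0 < |s| := abs_pos.2 hs
  set x := |β| / |s| with hx
  have hx0 : 0 ≤ x := by positivity
  have hx1 : x ≤ 1 := (div_le_one hs').2 h
  have hβ : |β| = |s| * x := by rw [hx]; field_simp
  have hsum : |s + β| ^ p + |s - β| ^ p = |s| ^ p * ((1 + x) ^ p + (1 - x) ^ p) := by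
    rw [mul_add, ← Real.mul_rpow hs'.le (by linarith), ← Real.mul_rpow hs'.le (by linarith),
      mul_add, mul_sub, mul_one, ← hβ]
    rcases le_total 0 s with h1 | h1 <;> rcases le_total 0 β with h2 | h2 <;>
      simp only [abs_of_nonneg, abs_of_nonpos, h1, h2] at h ⊢
    · rw [abs_of_nonneg (by linarith : 0 ≤ s + β), abs_of_nonneg (by linarith : 0 ≤ s - β)]
    · rw [abs_of_nonneg (by linarith : 0 ≤ s + β), abs_of_nonneg (by linarith : 0 ≤ s - β),
        add_comm]
      congr 2
      ring
    · rw [abs_of_nonpos (by linarith : s + β ≤ 0), abs_of_nonpos (by linarith : s - β ≤ 0),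
        add_comm]
      congr 2 <;> ring
    · rw [abs_of_nonpos (by linarith : s + β ≤ 0), abs_of_nonpos (by linarith : s - β ≤ 0)]
      congr 2 <;> ring
  have hleft : (s ^ 2 + (p - 1) * β ^ 2) ^ (p / 2)
      = |s| ^ p * (1 + (p - 1) * x ^ 2) ^ (p / 2) := by
    have h1 : s ^ 2 + (p - 1) * β ^ 2 = |s| ^ 2 * (1 + (p - 1) * x ^ 2) := by
      rw [← sq_abs β, hβ, ← sq_abs s]; ring
    have h2 : 0 ≤ (p - 1) * x ^ 2 := mul_nonneg (by linarith) (sq_nonneg x)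
    rw [h1, Real.mul_rpow (by positivity) (by linarith), ← Real.rpow_natCast_mul hs'.le]
    congr 2
    push_cast
    ring
  rw [hsum, hleft, mul_div_assoc]
  refine mul_le_mul_of_nonneg_left ?_ (by positivity)
  have h2 : 0 ≤ (p - 1) * x ^ 2 := mul_nonneg (by linarith) (sq_nonneg x)
  calc (1 + (p - 1) * x ^ 2) ^ (p / 2) ≤ 1 + p / 2 * ((p - 1) * x ^ 2) :=
        rpow_one_add_le_one_add_mul_self (by linarith) (by linarith) (by linarith)
    _ = 1 + p * (p - 1) / 2 * x ^ 2 := by ring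
    _ ≤ _ := one_add_sq_le_rpow_add_rpow hp1 hp2 hx0 hx1

/-- The two-point inequality expressing the `2`-uniform convexity of `L_p`, `1 < p ≤ 2`. -/
theorem two_point {p : ℝ} (hp1 : 1 < p) (hp2 : p ≤ 2) (s β : ℝ) :
    (s ^ 2 + (p - 1) * β ^ 2) ^ (p / 2) ≤ (|s + β| ^ p + |s - β| ^ p) / 2 := by
  rcases le_total |β| |s| with h | h
  · exact two_point_of_abs_le hp1 hp2 h
  · have h1 := two_point_of_abs_le hp1 hp2 h
    rw [add_comm β s, abs_sub_comm β s] at h1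
    refine le_trans (Real.rpow_le_rpow ?_ ?_ (by linarith)) h1
    · nlinarith [sq_nonneg s, sq_nonneg β]
    · have := sq_le_sq.2 h
      nlinarith

theorem rpow_add_rpow_le_of_convex {r u v d : ℝ} (hr : 1 ≤ r) (hu : 0 ≤ u) (hv : 0 ≤ v)
    (hd : 0 ≤ d) : (u + v) ^ r + (v + d) ^ r ≤ (u + v + d) ^ r + v ^ r := by
  rcases (add_nonneg hu hd).eq_or_lt with h | h
  · have h1 : u = 0 := by linarith
    have h2 : d = 0 := by linarith
    simp [h1, h2]
  have hc := (convexOn_rpow hr).2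
  have h1 := hc (x := v) hv (y := u + v + d) (Set.mem_Ici.2 (by positivity))
    (a := u / (u + d)) (b := d / (u + d)) (by positivity) (by positivity) (by field_simp)
  have h2 := hc (x := v) hv (y := u + v + d) (Set.mem_Ici.2 (by positivity))
    (a := d / (u + d)) (b := u / (u + d)) (by positivity) (by positivity)
    (by field_simp; ring)
  simp only [smul_eq_mul] at h1 h2
  rw [show u / (u + d) * v + d / (u + d) * (u + v + d) = v + d by field_simp; ring] at h1
  rw [show d / (u + d) * v + u / (u + d) * (u + v + d) = u + v by field_simp; ring] at h2
  have h3 : u / (u + d) + d / (u + d) = 1 := by field_simp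
  calc _ ≤ (u / (u + d) + d / (u + d)) * ((u + v + d) ^ r + v ^ r) := by linarith
    _ = _ := by rw [h3, one_mul]

/-- Passing from the two-point inequality on a set of measure `w` to the whole space, where
`u` is the contribution of the complement to the `p`-th power of the norm. -/
theorem rpow_two_div_add_le {p u w s β : ℝ} (hp1 : 1 < p) (hp2 : p ≤ 2) (hu : 0 ≤ u)
    (hw : 0 ≤ w) :
    (u + w * |s| ^ p) ^ (2 / p) + (p - 1) * (w ^ (2 / p) * β ^ 2) ≤
      (u + w * ((|s + β| ^ p + |s - β| ^ p) / 2)) ^ (2 / p) := by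
  have hp0 : 0 < p := by linarith
  have hd : 0 ≤ (p - 1) * β ^ 2 := mul_nonneg (by linarith) (sq_nonneg β)
  have hpow : (|s| ^ p) ^ (2 / p) = s ^ 2 := by
    rw [← Real.rpow_mul (abs_nonneg s), mul_div_cancel₀ _ hp0.ne']
    norm_num
  set e := (s ^ 2 + (p - 1) * β ^ 2) ^ (p / 2) with he
  have hse : |s| ^ p ≤ e := by
    have : |s| ^ p = (s ^ 2) ^ (p / 2) := by
      rw [← sq_abs, ← Real.rpow_natCast_mul (abs_nonneg s)]
      congr 1
      push_cast
      ring
    rw [this]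
    exact Real.rpow_le_rpow (sq_nonneg s) (by linarith) (by linarith)
  have hepow : e ^ (2 / p) = s ^ 2 + (p - 1) * β ^ 2 := by
    rw [he, ← Real.rpow_mul (by positivity), show p / 2 * (2 / p) = 1 by field_simp,
      Real.rpow_one]
  have h0 : 0 ≤ |s| ^ p := by positivity
  have hconv := rpow_add_rpow_le_of_convex (r := 2 / p) (u := u) (v := w * |s| ^ p)
    (d := w * e - w * |s| ^ p) ((one_le_div hp0).2 hp2) hu (by positivity)
    (sub_nonneg.2 (mul_le_mul_of_nonneg_left hse hw))
  rw [show w * |s| ^ p + (w * e - w * |s| ^ p) = w * e by ring,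
    show u + w * |s| ^ p + (w * e - w * |s| ^ p) = u + w * e by ring,
    Real.mul_rpow hw (h0.trans hse), Real.mul_rpow hw h0, hepow, hpow] at hconv
  have hmono : (u + w * e) ^ (2 / p) ≤
      (u + w * ((|s + β| ^ p + |s - β| ^ p) / 2)) ^ (2 / p) := by
    have : 0 ≤ w * e := mul_nonneg hw (h0.trans hse)
    refine Real.rpow_le_rpow (by linarith) ?_ (by positivity)
    gcongr
    exact two_point hp1 hp2 s β
  linarith

theorem abs_one_sub_rpow_le {p : ℝ} (hp1 : 1 < p) (hp2 : p ≤ 2) (t : ℝ) :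
    |1 - t| ^ p ≤ 1 - p * t + 2 * |t| ^ p := by
  rcases le_or_gt |t| 1 with h | h
  · obtain ⟨h1, h2⟩ := abs_le.1 h
    rw [abs_of_nonneg (by linarith)]
    have hsplit : (1 - t) ^ p = (1 - t) * (1 - t) ^ (p - 1) := by
      rw [← Real.rpow_one_add' (by linarith) (by linarith)]
      congr 1
      ring
    have hbern : (1 - t) ^ (p - 1) ≤ 1 - (p - 1) * t := by
      have := rpow_one_add_le_one_add_mul_self (s := -t) (p := p - 1) (by linarith)
        (by linarith) (by linarith)
      rw [← sub_eq_add_neg] at this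
      linarith
    have hsq : t ^ 2 ≤ |t| ^ p := by
      rw [← sq_abs, ← Real.rpow_natCast]
      rcases (abs_nonneg t).eq_or_lt with h0 | h0
      · rw [← h0]
        simp [Real.zero_rpow (show p ≠ 0 by linarith)]
      · exact Real.rpow_le_rpow_of_exponent_ge h0 h (by exact_mod_cast hp2)
    have := mul_le_mul_of_nonneg_left hbern (show 0 ≤ 1 - t by linarith)
    rw [hsplit]
    nlinarith [sq_nonneg t]
  · rcases lt_abs.1 h with h | h
    · rw [abs_sub_comm, abs_of_nonneg (by linarith), abs_of_pos (by linarith : 0 < t)]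
      have h1 : (t - 1) ^ p ≤ t ^ p :=
        Real.rpow_le_rpow (by linarith) (by linarith) (by linarith)
      have h2 := one_add_mul_self_le_rpow_one_add (s := t - 1) (p := p) (by linarith) hp1.le
      rw [add_sub_cancel] at h2
      linarith
    · obtain ⟨v, rfl⟩ : ∃ v, t = -v := ⟨-t, by ring⟩
      rw [neg_neg] at h
      rw [abs_neg, sub_neg_eq_add, abs_of_pos (by linarith), abs_of_pos (by linarith : 0 < v)]
      have hsplit : (1 + v) ^ p = (1 + v) * (1 + v) ^ (p - 1) := by
        rw [← Real.rpow_one_add' (by linarith) (by linarith)]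
        congr 1
        ring
      have hsplit' : v ^ p = v * v ^ (p - 1) := by
        rw [← Real.rpow_one_add' (by linarith) (by linarith)]
        congr 1
        ring
      have hsub : (1 + v) ^ (p - 1) ≤ 1 + v ^ (p - 1) := by
        simpa using Real.rpow_add_le_add_rpow zero_le_one (by linarith : 0 ≤ v)
          (by linarith : 0 ≤ p - 1) (by linarith)
      have h0 : 0 ≤ v ^ (p - 1) := Real.rpow_nonneg (by linarith) _
      rw [hsplit, hsplit']
      nlinarith [mul_le_mul_of_nonneg_left hsub (show 0 ≤ 1 + v by linarith),
        mul_nonneg h0 (show 0 ≤ v - 1 by linarith)]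

/-- A pointwise form of the smoothness of `L_p`, `1 < p ≤ 2`. -/
theorem abs_sub_rpow_le {p : ℝ} (hp1 : 1 < p) (hp2 : p ≤ 2) (a b : ℝ) :
    |a - b| ^ p ≤ |a| ^ p - p * (Real.sign a * |a| ^ (p - 1) * b) + 2 * |b| ^ p := by
  rcases eq_or_ne a 0 with rfl | ha
  · have : 0 ≤ |b| ^ p := by positivity
    simp [Real.zero_rpow (show p ≠ 0 by linarith)]
    linarith
  have ha' : 0 < |a| := abs_pos.2 ha
  have hone := mul_le_mul_of_nonneg_left (abs_one_sub_rpow_le hp1 hp2 (b / a))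
    (show 0 ≤ |a| ^ p by positivity)
  have h1 : |a| ^ p * |1 - b / a| ^ p = |a - b| ^ p := by
    rw [← Real.mul_rpow (abs_nonneg _) (abs_nonneg _), ← abs_mul]
    congr 2
    field_simp
  have h2 : |a| ^ p * |b / a| ^ p = |b| ^ p := by
    rw [← Real.mul_rpow (abs_nonneg _) (abs_nonneg _), ← abs_mul]
    congr 2
    field_simp
  have h3 : |a| ^ p * (b / a) = Real.sign a * |a| ^ (p - 1) * b := by
    rw [Real.rpow_sub_one ha'.ne']
    rcases ha.lt_or_gt with h | h
    · rw [Real.sign_of_neg h, abs_of_neg h]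
      field_simp
    · rw [Real.sign_of_pos h, abs_of_pos h]
      field_simp
  rw [h1] at hone
  linear_combination hone + 2 * h2 - p * h3

/-! ### Bounded measurable functions and their `p`-norms -/

/-- A bounded measurable real function. -/
def BoundedMeasurable (f : ℝ → ℝ) : Prop :=
  Measurable f ∧ ∃ C, ∀ t, |f t| ≤ C

namespace BoundedMeasurable

variable {f g : ℝ → ℝ}

theorem add (hf : BoundedMeasurable f) (hg : BoundedMeasurable g) :
    BoundedMeasurable fun t => f t + g t := by
  obtain ⟨hfm, C, hC⟩ := hf
  obtain ⟨hgm, D, hD⟩ := hg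
  exact ⟨hfm.add hgm, C + D, fun t => (abs_add_le _ _).trans (add_le_add (hC t) (hD t))⟩

theorem mul (hf : BoundedMeasurable f) (hg : BoundedMeasurable g) :
    BoundedMeasurable fun t => f t * g t := by
  obtain ⟨hfm, C, hC⟩ := hf
  obtain ⟨hgm, D, hD⟩ := hg
  refine ⟨hfm.mul hgm, C * D, fun t => ?_⟩
  rw [abs_mul]
  exact mul_le_mul (hC t) (hD t) (abs_nonneg _) ((abs_nonneg _).trans (hC t))

theorem const (c : ℝ) : BoundedMeasurable fun _ => c :=
  ⟨measurable_const, |c|, fun _ => le_rfl⟩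

theorem sub (hf : BoundedMeasurable f) (hg : BoundedMeasurable g) :
    BoundedMeasurable fun t => f t - g t := by
  simpa [sub_eq_add_neg] using hf.add ((const (-1)).mul hg)

theorem abs_rpow (hf : BoundedMeasurable f) {r : ℝ} (hr : 0 ≤ r) :
    BoundedMeasurable fun t => |f t| ^ r := by
  obtain ⟨hfm, C, hC⟩ := hf
  refine ⟨(measurable_norm.comp hfm).pow_const r, C ^ r, fun t => ?_⟩
  rw [abs_of_nonneg (by positivity)]
  exact Real.rpow_le_rpow (abs_nonneg _) (hC t) hr

theorem indicator_one {s : Set ℝ} (hs : MeasurableSet s) :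
    BoundedMeasurable (s.indicator 1) := by
  refine ⟨measurable_one.indicator hs, 1, fun t => ?_⟩
  by_cases h : t ∈ s <;> simp [h]

theorem sign (hf : BoundedMeasurable f) : BoundedMeasurable fun t => Real.sign (f t) := by
  refine ⟨?_, 1, fun t => ?_⟩
  · have : Measurable Real.sign :=
      Measurable.ite measurableSet_Iio measurable_const
        (Measurable.ite measurableSet_Ioi measurable_const measurable_const)
    exact this.comp hf.1
  · rcases Real.sign_apply_eq (f t) with h | h | h <;> simp [h]

theorem sum {ι : Type*} (s : Finset ι) {F : ι → ℝ → ℝ} (hF : ∀ i, BoundedMeasurable (F i)) :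
    BoundedMeasurable fun t => ∑ i ∈ s, F i t := by
  classical
  induction s using Finset.induction_on with
  | empty => simpa using const 0
  | insert a s ha ih => simpa [Finset.sum_insert ha] using (hF a).add ih

theorem integrable (hf : BoundedMeasurable f) (μ : Measure ℝ) [IsFiniteMeasure μ] :
    Integrable f μ := by
  obtain ⟨hfm, C, hC⟩ := hf
  exact Integrable.of_bound hfm.aestronglyMeasurable C (Filter.Eventually.of_forall hC)

theorem pnorm_eq (hf : BoundedMeasurable f) {p : ℝ} (hp : 0 < p) :
    pnorm p f = (∫ t in Set.Ico (0 : ℝ) 1, |f t| ^ p) ^ (1 / p) := by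
  obtain ⟨hfm, C, hC⟩ := hf
  have hmem : MemLp f (ENNReal.ofReal p) (volume.restrict (Set.Ico (0 : ℝ) 1)) :=
    MemLp.of_bound hfm.aestronglyMeasurable C (Filter.Eventually.of_forall hC)
  rw [pnorm, hmem.eLpNorm_eq_integral_rpow_norm (by simpa using hp) ENNReal.ofReal_ne_top,
    ENNReal.toReal_ofReal hp.le, ENNReal.toReal_ofReal (by positivity)]
  simp [Real.norm_eq_abs]

theorem pnorm_rpow (hf : BoundedMeasurable f) {p : ℝ} (hp : 0 < p) :
    pnorm p f ^ p = ∫ t in Set.Ico (0 : ℝ) 1, |f t| ^ p := by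
  rw [hf.pnorm_eq hp, ← Real.rpow_mul (by positivity), one_div_mul_cancel hp.ne',
    Real.rpow_one]

theorem pnorm_sq (hf : BoundedMeasurable f) {p : ℝ} (hp : 0 < p) :
    pnorm p f ^ 2 = (∫ t in Set.Ico (0 : ℝ) 1, |f t| ^ p) ^ (2 / p) := by
  rw [hf.pnorm_eq hp, ← Real.rpow_mul_natCast (by positivity)]
  congr 1
  push_cast
  ring

end BoundedMeasurable

theorem pnorm_nonneg (p : ℝ) (f : ℝ → ℝ) : 0 ≤ pnorm p f := ENNReal.toReal_nonneg

/-! ### Structure of the Haar functions -/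

/-- A Haar function of positive index lives on a dyadic interval on which all the preceding
Haar functions are constant. -/
theorem exists_haarFn_eq {n : ℕ} (hn : n ≠ 0) :
    ∃ a w : ℝ, 0 ≤ a ∧ 0 < w ∧ a + 2 * w ≤ 1 ∧
      (haarFn n = fun t => (Set.Ico a (a + w)).indicator 1 t -
        (Set.Ico (a + w) (a + 2 * w)).indicator 1 t) ∧
      ∀ i < n, ∃ v, ∀ t ∈ Set.Ico a (a + 2 * w), haarFn i t = v := by
  obtain ⟨N, hN⟩ : ∃ N, N = Nat.log 2 n := ⟨_, rfl⟩
  have hle : 2 ^ N ≤ n := hN ▸ Nat.pow_log_le_self 2 hn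
  have hlt : n < 2 ^ (N + 1) := hN ▸ Nat.lt_pow_succ_log_self one_lt_two n
  obtain ⟨k, hk⟩ : ∃ k, k = n - 2 ^ N := ⟨_, rfl⟩
  have hkN : k + 1 ≤ 2 ^ N := by rw [pow_succ] at hlt; omega
  have hkN' : (k : ℝ) + 1 ≤ 2 ^ N := by exact_mod_cast hkN
  have hend : (k : ℝ) / 2 ^ N + 2 * (1 / 2 ^ (N + 1)) = (k + 1) / 2 ^ N := by
    rw [pow_succ]; field_simp
  have hmid : (k : ℝ) / 2 ^ N + 1 / 2 ^ (N + 1) = (2 * k + 1) / 2 ^ (N + 1) := by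
    rw [pow_succ]; field_simp
  refine ⟨k / 2 ^ N, 1 / 2 ^ (N + 1), by positivity, by positivity, ?_, ?_, ?_⟩
  · rw [hend]
    exact (div_le_one (by positivity)).2 hkN'
  · rw [hend, hmid, haarFn, if_neg hn]
    simp only [← hN, ← hk]
  intro i hi
  rw [hend]
  -- membership in a dyadic half-line of the same generation does not depend on the point
  have hdyadic : ∀ j : ℕ, ∀ t ∈ Set.Ico ((k : ℝ) / 2 ^ N) ((k + 1) / 2 ^ N),
      ((j : ℝ) / 2 ^ N ≤ t ↔ j ≤ k) := by
    intro j t ht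
    constructor
    · intro h
      have : (j : ℝ) < k + 1 := (div_lt_div_iff_of_pos_right (by positivity)).1 (h.trans_lt ht.2)
      have : j < k + 1 := by exact_mod_cast this
      omega
    · intro h
      refine le_trans ?_ ht.1
      gcongr
  have hIco : ∀ j l : ℕ, ∀ t ∈ Set.Ico ((k : ℝ) / 2 ^ N) ((k + 1) / 2 ^ N),
      (Set.Ico ((j : ℝ) / 2 ^ N) ((l : ℝ) / 2 ^ N)).indicator (1 : ℝ → ℝ) t =
        if j ≤ k ∧ ¬ l ≤ k then 1 else 0 := by
    intro j l t ht
    simp only [Set.indicator_apply, Set.mem_Ico, ← not_le (a := (l : ℝ) / 2 ^ N),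
      hdyadic _ t ht, Pi.one_apply]
  rcases eq_or_ne i 0 with rfl | hi0
  · refine ⟨1, fun t ht => ?_⟩
    have h0 : 0 ≤ t := le_trans (by positivity) ht.1
    have h1 : t < 1 := ht.2.trans_le ((div_le_one (by positivity)).2 hkN')
    simp [haarFn, h0, h1]
  obtain ⟨M, hM⟩ : ∃ M, M = Nat.log 2 i := ⟨_, rfl⟩
  obtain ⟨j, hj⟩ : ∃ j, j = i - 2 ^ M := ⟨_, rfl⟩
  have hMN : M ≤ N := by rw [hM, hN]; exact Nat.log_mono_right hi.le
  have hMi : 2 ^ M ≤ i := hM ▸ Nat.pow_log_le_self 2 hi0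
  simp only [haarFn, if_neg hi0, ← hM, ← hj]
  rcases hMN.eq_or_lt with rfl | hMN
  · refine ⟨0, fun t ht => ?_⟩
    have hjk : j + 1 ≤ k := by omega
    have h1 : ((j : ℝ) + 1) / 2 ^ M ≤ t := by
      have := (hdyadic (j + 1) t ht).2 hjk
      exact_mod_cast this
    have h2 : (2 * (j : ℝ) + 1) / 2 ^ (M + 1) ≤ t := by
      refine le_trans ?_ h1
      rw [pow_succ, div_le_div_iff₀ (by positivity) (by positivity)]
      nlinarith [show (0 : ℝ) < 2 ^ M by positivity]
    simp [h1, h2]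
  · obtain ⟨d, rfl⟩ : ∃ d, N = M + 1 + d := ⟨N - (M + 1), by omega⟩
    have e1 : (j : ℝ) / 2 ^ M = ((2 * j * 2 ^ d : ℕ) : ℝ) / 2 ^ (M + 1 + d) := by
      push_cast; rw [pow_add, pow_succ]; field_simp
    have e2 : (2 * (j : ℝ) + 1) / 2 ^ (M + 1) =
        (((2 * j + 1) * 2 ^ d : ℕ) : ℝ) / 2 ^ (M + 1 + d) := by
      push_cast; rw [pow_add (2 : ℝ) (M + 1) d]; field_simp
    have e3 : ((j : ℝ) + 1) / 2 ^ M = ((2 * (j + 1) * 2 ^ d : ℕ) : ℝ) / 2 ^ (M + 1 + d) := by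
      push_cast; rw [pow_add, pow_succ]; field_simp
    rw [e1, e2, e3]
    exact ⟨_, fun t ht => by rw [hIco _ _ t ht, hIco _ _ t ht]⟩

theorem boundedMeasurable_haarFn (i : ℕ) : BoundedMeasurable (haarFn i) := by
  rcases eq_or_ne i 0 with rfl | hi
  · simpa [haarFn] using BoundedMeasurable.indicator_one measurableSet_Ico
  · obtain ⟨a, w, -, -, -, h, -⟩ := exists_haarFn_eq hi
    rw [h]
    exact (BoundedMeasurable.indicator_one measurableSet_Ico).sub
      (BoundedMeasurable.indicator_one measurableSet_Ico)

theorem boundedMeasurable_haarFnP (p : ℝ) (i : ℕ) : BoundedMeasurable (haarFnP p i) := by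
  have : haarFnP p i = fun t => haarFn i t * (pnorm p (haarFn i))⁻¹ :=
    funext fun t => div_eq_mul_inv _ _
  exact this ▸ (boundedMeasurable_haarFn i).mul (BoundedMeasurable.const _)

theorem boundedMeasurable_sum_haarFnP (p : ℝ) (b : ℕ → ℝ) (A : Finset ℕ) :
    BoundedMeasurable fun t => ∑ i ∈ A, b i * haarFnP p i t :=
  BoundedMeasurable.sum A fun i =>
    (BoundedMeasurable.const (b i)).mul (boundedMeasurable_haarFnP p i)

theorem setIntegral_indicator_Ico {a b : ℝ} (ha : 0 ≤ a) (hab : a ≤ b) (hb : b ≤ 1) :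
    ∫ t in Set.Ico (0 : ℝ) 1, (Set.Ico a b).indicator (1 : ℝ → ℝ) t = b - a := by
  rw [integral_indicator_one measurableSet_Ico, measureReal_restrict_apply measurableSet_Ico,
    Set.inter_eq_left.2 (Set.Ico_subset_Ico ha hb), Real.volume_real_Ico_of_le hab]

/-- The effect on `∫ |f|^p` of adding a multiple of a Haar-like function supported where `f`
is constant. -/
theorem integral_abs_add_haar_rpow {p : ℝ} (hp : 0 < p) {f : ℝ → ℝ} (hf : BoundedMeasurable f)
    {a w s : ℝ} (ha : 0 ≤ a) (hw : 0 < w) (haw : a + 2 * w ≤ 1)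
    (hs : ∀ t ∈ Set.Ico a (a + 2 * w), f t = s) (β : ℝ) :
    ∃ u, 0 ≤ u ∧ ∫ t in Set.Ico (0 : ℝ) 1, |f t| ^ p = u + 2 * w * |s| ^ p ∧
      ∫ t in Set.Ico (0 : ℝ) 1, |f t + β * ((Set.Ico a (a + w)).indicator 1 t -
        (Set.Ico (a + w) (a + 2 * w)).indicator 1 t)| ^ p =
          u + 2 * w * ((|s + β| ^ p + |s - β| ^ p) / 2) := by
  have hfi := (hf.abs_rpow hp.le).integrable (volume.restrict (Set.Ico (0 : ℝ) 1))
  have hL := (BoundedMeasurable.indicator_one (measurableSet_Ico (a := a) (b := a + w))).integrable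
    (volume.restrict (Set.Ico (0 : ℝ) 1))
  have hR := (BoundedMeasurable.indicator_one
    (measurableSet_Ico (a := a + w) (b := a + 2 * w))).integrable
    (volume.restrict (Set.Ico (0 : ℝ) 1))
  have hI := (BoundedMeasurable.indicator_one
    (measurableSet_Ico (a := a) (b := a + 2 * w))).integrable
    (volume.restrict (Set.Ico (0 : ℝ) 1))
  refine ⟨(∫ t in Set.Ico (0 : ℝ) 1, |f t| ^ p) - 2 * w * |s| ^ p, ?_, by ring, ?_⟩
  · have hint : ∫ t in Set.Ico (0 : ℝ) 1,
        (Set.Ico a (a + 2 * w)).indicator (1 : ℝ → ℝ) t * |s| ^ p = 2 * w * |s| ^ p := by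
      rw [integral_mul_const, setIntegral_indicator_Ico ha (by linarith) haw]
      ring
    rw [← hint, sub_nonneg]
    refine integral_mono (hI.mul_const _) hfi fun t => ?_
    by_cases ht : t ∈ Set.Ico a (a + 2 * w)
    · simp [Set.indicator_of_mem ht, hs t ht]
    · simp only [Set.indicator_of_notMem ht, zero_mul]
      positivity
  · have hpt : ∀ t, |f t + β * ((Set.Ico a (a + w)).indicator 1 t -
        (Set.Ico (a + w) (a + 2 * w)).indicator 1 t)| ^ p =
        |f t| ^ p + ((Set.Ico a (a + w)).indicator 1 t * (|s + β| ^ p - |s| ^ p) +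
          (Set.Ico (a + w) (a + 2 * w)).indicator 1 t * (|s - β| ^ p - |s| ^ p)) := by
      intro t
      by_cases h1 : t ∈ Set.Ico a (a + w)
      · have h2 : t ∉ Set.Ico (a + w) (a + 2 * w) := fun h => (h.1.trans_lt h1.2).false
        have h3 := hs t ⟨h1.1, h1.2.trans (by linarith)⟩
        simp [Set.indicator_of_mem h1, Set.indicator_of_notMem h2, h3]
      · by_cases h2 : t ∈ Set.Ico (a + w) (a + 2 * w)
        · have h3 := hs t ⟨le_trans (by linarith) h2.1, h2.2⟩
          simp [Set.indicator_of_notMem h1, Set.indicator_of_mem h2, h3, ← sub_eq_add_neg]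
        · simp [Set.indicator_of_notMem h1, Set.indicator_of_notMem h2]
    simp only [hpt]
    rw [integral_add hfi (by exact (hL.mul_const _).add (hR.mul_const _)),
      integral_add (hL.mul_const _) (hR.mul_const _), integral_mul_const, integral_mul_const,
      setIntegral_indicator_Ico ha (by linarith) (by linarith),
      setIntegral_indicator_Ico (by linarith) (by linarith) haw]
    ring

theorem pnorm_haarFn_zero {p : ℝ} (hp : 0 < p) : pnorm p (haarFn 0) = 1 := by
  rw [(boundedMeasurable_haarFn 0).pnorm_eq hp,
    setIntegral_congr_fun (g := fun _ => (1 : ℝ)) measurableSet_Ico]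
  · simp
  · intro t ht
    simp [haarFn, Set.indicator_of_mem ht]

theorem pnorm_haarFn_pos {p : ℝ} (hp : 0 < p) (n : ℕ) : 0 < pnorm p (haarFn n) := by
  rcases eq_or_ne n 0 with rfl | hn
  · rw [pnorm_haarFn_zero hp]
    exact one_pos
  obtain ⟨a, w, ha, hw, haw, h, -⟩ := exists_haarFn_eq hn
  obtain ⟨u, hu, -, h2⟩ := integral_abs_add_haar_rpow hp (BoundedMeasurable.const 0) ha hw haw
    (fun _ _ => rfl) 1
  rw [(boundedMeasurable_haarFn n).pnorm_eq hp, h]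
  simp only [zero_add, one_mul] at h2
  rw [h2]
  simp only [zero_sub, abs_neg, abs_one, Real.one_rpow]
  positivity

theorem pnorm_haarFn_sq {p : ℝ} (hp : 0 < p) {n : ℕ} {a w : ℝ} (ha : 0 ≤ a) (hw : 0 < w)
    (haw : a + 2 * w ≤ 1)
    (h : haarFn n = fun t => (Set.Ico a (a + w)).indicator 1 t -
      (Set.Ico (a + w) (a + 2 * w)).indicator 1 t) :
    pnorm p (haarFn n) ^ 2 = (2 * w) ^ (2 / p) := by
  obtain ⟨u, hu, h1, h2⟩ := integral_abs_add_haar_rpow hp (BoundedMeasurable.const 0) ha hw haw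
    (fun _ _ => rfl) 1
  rw [(boundedMeasurable_haarFn n).pnorm_sq hp, h]
  simp only [zero_add, one_mul] at h2
  rw [h2]
  simp [Real.zero_rpow hp.ne'] at h1 ⊢
  simp [← h1]

theorem pnorm_haarFnP {p : ℝ} (hp : 0 < p) (n : ℕ) : pnorm p (haarFnP p n) = 1 := by
  have h0 := pnorm_haarFn_pos hp n
  have hp1 : pnorm p (haarFnP p n) ^ p = 1 := by
    rw [(boundedMeasurable_haarFnP p n).pnorm_rpow hp]
    simp only [haarFnP, abs_div, abs_of_pos h0]
    simp only [Real.div_rpow (abs_nonneg _) h0.le]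
    rw [integral_div, ← (boundedMeasurable_haarFn n).pnorm_rpow hp]
    exact div_self (Real.rpow_pos_of_pos h0 _).ne'
  have h := congrArg (fun x : ℝ => x ^ (1 / p)) hp1
  simpa [← Real.rpow_mul (pnorm_nonneg p _), hp.ne'] using h

/-- The lower `2`-estimate for the normalized Haar system in `L_p`, `1 < p ≤ 2`. -/
theorem sum_sq_le_pnorm_sq {p : ℝ} (hp1 : 1 < p) (hp2 : p ≤ 2) (b : ℕ → ℝ) (A : Finset ℕ) :
    (p - 1) * ∑ i ∈ A, b i ^ 2 ≤ pnorm p (fun t => ∑ i ∈ A, b i * haarFnP p i t) ^ 2 := by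
  have hp0 : 0 < p := by linarith
  induction A using Finset.induction_on_max with
  | empty => simpa using sq_nonneg _
  | insert n A hlt ih =>
    have hnA : n ∉ A := fun h => (hlt n h).false
    have hf := boundedMeasurable_sum_haarFnP p b A
    have hg := boundedMeasurable_sum_haarFnP p b (insert n A)
    set ν := pnorm p (haarFn n) with hν
    have hν0 : 0 < ν := pnorm_haarFn_pos hp0 n
    rcases eq_or_ne n 0 with rfl | hn
    · have hA : A = ∅ := Finset.eq_empty_of_forall_notMem fun i hi => by
        simpa using hlt i hi
      subst hA
      have h1 : ∫ t in Set.Ico (0 : ℝ) 1, |b 0 * haarFnP p 0 t| ^ p = |b 0| ^ p := by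
        have := (boundedMeasurable_haarFnP p 0).pnorm_rpow hp0
        rw [pnorm_haarFnP hp0, Real.one_rpow] at this
        simp only [abs_mul, Real.mul_rpow (abs_nonneg _) (abs_nonneg _)]
        rw [integral_const_mul, ← this, mul_one]
      rw [hg.pnorm_sq hp0]
      simp only [insert_empty_eq, Finset.sum_singleton]
      rw [h1, ← Real.rpow_mul (abs_nonneg _), mul_div_cancel₀ _ hp0.ne']
      norm_num
      nlinarith [sq_nonneg (b 0)]
    obtain ⟨a, w, ha, hw, haw, h, hconst⟩ := exists_haarFn_eq hn
    choose! v hv using hconst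
    have hs : ∀ t ∈ Set.Ico a (a + 2 * w), ∑ i ∈ A, b i * haarFnP p i t =
        ∑ i ∈ A, b i * (v i / pnorm p (haarFn i)) := fun t ht =>
      Finset.sum_congr rfl fun i hi => by rw [haarFnP, hv i (hlt i hi) t ht]
    obtain ⟨u, hu, hint, hint'⟩ := integral_abs_add_haar_rpow hp0 hf ha hw haw hs (b n / ν)
    have hstep := rpow_two_div_add_le hp1 hp2 hu (by positivity : 0 ≤ 2 * w)
      (s := ∑ i ∈ A, b i * (v i / pnorm p (haarFn i))) (β := b n / ν)
    rw [← hint, ← hint', ← hf.pnorm_sq hp0, ← pnorm_haarFn_sq hp0 ha hw haw h, ← hν,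
      div_pow, mul_div_cancel₀ _ (by positivity)] at hstep
    rw [hg.pnorm_sq hp0, Finset.sum_insert hnA]
    have heq : (fun t => |∑ i ∈ insert n A, b i * haarFnP p i t| ^ p) = fun t =>
        |∑ i ∈ A, b i * haarFnP p i t + b n / ν * ((Set.Ico a (a + w)).indicator 1 t -
          (Set.Ico (a + w) (a + 2 * w)).indicator 1 t)| ^ p := by
      funext t
      rw [Finset.sum_insert hnA, add_comm]
      congr 3
      rw [haarFnP, ← hν, h]
      ring
    rw [heq]
    linarith

/-! ### The greedy step -/

theorem normingF_self {p : ℝ} (hp1 : 1 < p) {y : ℝ → ℝ} (hy : BoundedMeasurable y)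
    (hy0 : 0 < pnorm p y) : normingF p y y = pnorm p y := by
  have hpt : ∀ t, Real.sign (y t) * |y t| ^ (p - 1) * y t = |y t| ^ p := by
    intro t
    rcases eq_or_ne (y t) 0 with h | h
    · simp [h, Real.zero_rpow (show p ≠ 0 by linarith)]
    · have hsign : Real.sign (y t) * y t = |y t| := by
        rcases h.lt_or_gt with h | h
        · rw [Real.sign_of_neg h, abs_of_neg h, neg_one_mul]
        · rw [Real.sign_of_pos h, abs_of_pos h, one_mul]
      rw [mul_right_comm, hsign, Real.rpow_sub_one (abs_pos.2 h).ne']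
      field_simp
  simp only [normingF, hpt]
  rw [← hy.pnorm_rpow (by linarith), ← Real.rpow_add hy0]
  simp

theorem normingF_sum {p : ℝ} (hp1 : 1 < p) {y : ℝ → ℝ} (hy : BoundedMeasurable y) (b : ℕ → ℝ)
    (A : Finset ℕ) :
    normingF p y (fun t => ∑ i ∈ A, b i * haarFnP p i t) =
      ∑ i ∈ A, b i * normingF p y (haarFnP p i) := by
  simp only [normingF, Finset.mul_sum]
  rw [integral_finsetSum, Finset.mul_sum]
  · refine Finset.sum_congr rfl fun i _ => ?_
    rw [mul_left_comm, ← integral_const_mul (b i)]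
    congr 2
    funext t
    ring
  · intro i _
    exact ((hy.sign.mul (hy.abs_rpow (by linarith))).mul
      ((BoundedMeasurable.const _).mul (boundedMeasurable_haarFnP p i))).integrable _

theorem pnorm_sub_rpow_le {p : ℝ} (hp1 : 1 < p) (hp2 : p ≤ 2) {y h : ℝ → ℝ}
    (hy : BoundedMeasurable y) (hy0 : 0 < pnorm p y) (hh : BoundedMeasurable h)
    (hh1 : pnorm p h = 1) (lam : ℝ) :
    pnorm p (fun t => y t - lam * h t) ^ p ≤
      pnorm p y ^ p - p * (lam * (pnorm p y ^ (p - 1) * normingF p y h)) + 2 * |lam| ^ p := by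
  have hp0 : 0 < p := by linarith
  have hlh := (BoundedMeasurable.const lam).mul hh
  have hsub := hy.sub hlh
  have hF : pnorm p y ^ (p - 1) * normingF p y h =
      ∫ t in Set.Ico (0 : ℝ) 1, Real.sign (y t) * |y t| ^ (p - 1) * h t := by
    rw [normingF, ← mul_assoc, ← Real.rpow_add hy0]
    simp
  have h1 : ∫ t in Set.Ico (0 : ℝ) 1, |lam * h t| ^ p = |lam| ^ p := by
    have := hh.pnorm_rpow hp0
    rw [hh1, Real.one_rpow] at this
    simp only [abs_mul, Real.mul_rpow (abs_nonneg _) (abs_nonneg _)]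
    rw [integral_const_mul, ← this, mul_one]
  have h2 : ∫ t in Set.Ico (0 : ℝ) 1, Real.sign (y t) * |y t| ^ (p - 1) * (lam * h t) =
      lam * (pnorm p y ^ (p - 1) * normingF p y h) := by
    rw [hF, ← integral_const_mul]
    congr 1
    funext t
    ring
  have hi1 := (hy.abs_rpow hp0.le).integrable (volume.restrict (Set.Ico (0 : ℝ) 1))
  have hi2 := ((hy.sign.mul (hy.abs_rpow (r := p - 1) (by linarith))).mul hlh).integrable
    (volume.restrict (Set.Ico (0 : ℝ) 1))
  have hi3 := (hlh.abs_rpow hp0.le).integrable (volume.restrict (Set.Ico (0 : ℝ) 1))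
  rw [hsub.pnorm_rpow hp0, hy.pnorm_rpow hp0, ← h2, ← h1, ← integral_const_mul p,
    ← integral_const_mul 2, ← integral_sub hi1 (hi2.const_mul p),
    ← integral_add (by exact hi1.sub (hi2.const_mul p)) (hi3.const_mul 2)]
  exact integral_mono ((hsub.abs_rpow hp0.le).integrable _)
    ((hi1.sub (hi2.const_mul p)).add (hi3.const_mul 2)) fun t => abs_sub_rpow_le hp1 hp2 _ _

/-- One step in the direction of a normalized `h` reduces the norm by a factor controlled by
the norming functional. -/
theorem iInf_pnorm_sub_le {p : ℝ} (hp1 : 1 < p) (hp2 : p ≤ 2) {y h : ℝ → ℝ}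
    (hy : BoundedMeasurable y) (hy0 : 0 < pnorm p y) (hh : BoundedMeasurable h)
    (hh1 : pnorm p h = 1) :
    (⨅ lam : ℝ, pnorm p (fun t => y t - lam * h t)) ≤
      (1 - (p - 1) / p * 2 * (|normingF p y h| / 2) ^ (p / (p - 1))) * pnorm p y := by
  have hp0 : 0 < p := by linarith
  set F := normingF p y h with hF
  set Y := pnorm p y with hY
  set τ := (|F| / 2) ^ (1 / (p - 1)) with hτ
  have hτ0 : 0 ≤ τ := by positivity
  have hpm : p - 1 ≠ 0 := by linarith
  have hτF : τ ^ (p - 1) = |F| / 2 := by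
    rw [hτ, ← Real.rpow_mul (by positivity), one_div_mul_cancel hpm, Real.rpow_one]
  have hτp : τ ^ p = τ * (|F| / 2) := by
    rw [← hτF, ← Real.rpow_one_add' hτ0 (by linarith)]
    congr 1
    ring
  set X := (p - 1) * 2 * (|F| / 2) ^ (p / (p - 1)) with hX
  have hXτ : (|F| / 2) ^ (p / (p - 1)) = τ ^ p := by
    rw [hτ, ← Real.rpow_mul (by positivity)]
    congr 1
    field_simp
  obtain ⟨ε, hε1, hεF⟩ : ∃ ε : ℝ, |ε| ≤ 1 ∧ ε * F = |F| := by
    rcases abs_cases F with h | h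
    · exact ⟨1, by simp, by rw [h.1, one_mul]⟩
    · exact ⟨-1, by simp, by rw [h.1, neg_one_mul]⟩
  have hstep := pnorm_sub_rpow_le hp1 hp2 hy hy0 hh hh1 (Y * τ * ε)
  rw [← hF, ← hY] at hstep
  set Z := pnorm p (fun t => y t - Y * τ * ε * h t) with hZ
  have hZ0 : 0 ≤ Z := pnorm_nonneg _ _
  have hYp : Y * Y ^ (p - 1) = Y ^ p := by
    rw [← Real.rpow_one_add' hy0.le (by linarith)]
    congr 1
    ring
  have hlam : |Y * τ * ε| ^ p ≤ Y ^ p * τ ^ p := by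
    rw [← Real.mul_rpow hy0.le hτ0]
    refine Real.rpow_le_rpow (abs_nonneg _) ?_ hp0.le
    rw [abs_mul, abs_of_nonneg (by positivity : 0 ≤ Y * τ)]
    exact mul_le_of_le_one_right (by positivity) hε1
  have hlin : Y * τ * ε * (Y ^ (p - 1) * F) = Y ^ p * (2 * τ ^ p) := by
    rw [hτp, ← hYp]
    linear_combination Y * τ * Y ^ (p - 1) * hεF
  have hZX : Z ^ p ≤ Y ^ p * (1 - X) := by
    rw [hX, hXτ]
    rw [hlin] at hstep
    nlinarith
  have hYp0 : 0 < Y ^ p := Real.rpow_pos_of_pos hy0 p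
  have hX1 : 0 ≤ 1 - X := by
    have : 0 ≤ Y ^ p * (1 - X) := (Real.rpow_nonneg hZ0 p).trans hZX
    exact nonneg_of_mul_nonneg_right this hYp0
  have hZle : Z ≤ Y * (1 - X) ^ (1 / p) := by
    have := Real.rpow_le_rpow (Real.rpow_nonneg hZ0 p) hZX (by positivity : 0 ≤ 1 / p)
    rwa [← Real.rpow_mul hZ0, mul_one_div_cancel hp0.ne', Real.rpow_one,
      Real.mul_rpow hYp0.le hX1, ← Real.rpow_mul hy0.le, mul_one_div_cancel hp0.ne',
      Real.rpow_one] at this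
  have hbern : (1 - X) ^ (1 / p) ≤ 1 - 1 / p * X := by
    have := rpow_one_add_le_one_add_mul_self (s := -X) (p := 1 / p) (by linarith)
      (by positivity) ((div_le_one hp0).2 hp1.le)
    rw [← sub_eq_add_neg] at this
    linarith
  have hbdd : BddBelow (Set.range fun lam : ℝ => pnorm p (fun t => y t - lam * h t)) :=
    ⟨0, by rintro _ ⟨lam, rfl⟩; exact pnorm_nonneg _ _⟩
  calc _ ≤ Z := ciInf_le hbdd (Y * τ * ε)
    _ ≤ Y * (1 - 1 / p * X) := hZle.trans (mul_le_mul_of_nonneg_left hbern hy0.le)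
    _ = _ := by rw [hX]; ring

/-- The norming functional of a combination of `m` Haar functions is at least of order
`m ^ (-1/2)` on one of them. -/
theorem sub_one_le_card_mul_sq_of_normingF_le {p : ℝ} (hp1 : 1 < p) (hp2 : p ≤ 2)
    {A : Finset ℕ} {b : ℕ → ℝ} {y : ℝ → ℝ}
    (hy : y = fun t => ∑ i ∈ A, b i * haarFnP p i t) (hy0 : 0 < pnorm p y)
    {M : ℝ} (hM : ∀ i ∈ A, |normingF p y (haarFnP p i)| ≤ M) :
    (p - 1) ≤ A.card * M ^ 2 := by
  have hb := sum_sq_le_pnorm_sq hp1 hp2 b A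
  rw [← hy] at hb
  have hym : BoundedMeasurable y := hy ▸ boundedMeasurable_sum_haarFnP p b A
  have hsum : pnorm p y = ∑ i ∈ A, b i * normingF p y (haarFnP p i) := by
    rw [← normingF_sum hp1 hym, ← hy, normingF_self hp1 hym hy0]
  have hcs : pnorm p y ^ 2 ≤ (∑ i ∈ A, b i ^ 2) * ∑ i ∈ A, normingF p y (haarFnP p i) ^ 2 := by
    nth_rewrite 1 [hsum]
    exact Finset.sum_mul_sq_le_sq_mul_sq _ _ _
  have hFM : ∑ i ∈ A, normingF p y (haarFnP p i) ^ 2 ≤ A.card * M ^ 2 := by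
    rw [← nsmul_eq_mul]
    refine Finset.sum_le_card_nsmul _ _ _ fun i hi => ?_
    rw [← sq_abs]
    exact pow_le_pow_left₀ (abs_nonneg _) (hM i hi) 2
  have hb0 : 0 ≤ ∑ i ∈ A, b i ^ 2 := Finset.sum_nonneg fun i _ => sq_nonneg _
  have hYsq : 0 < pnorm p y ^ 2 := by positivity
  have hchain : (p - 1) * pnorm p y ^ 2 ≤ (A.card * M ^ 2) * pnorm p y ^ 2 := by
    calc (p - 1) * pnorm p y ^ 2
        ≤ (p - 1) * ((∑ i ∈ A, b i ^ 2) * (A.card * M ^ 2)) :=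
          mul_le_mul_of_nonneg_left (hcs.trans (mul_le_mul_of_nonneg_left hFM hb0))
            (by linarith)
      _ = (A.card * M ^ 2) * ((p - 1) * ∑ i ∈ A, b i ^ 2) := by ring
      _ ≤ _ := mul_le_mul_of_nonneg_left hb (by positivity)
  exact le_of_mul_le_mul_right hchain hYsq

theorem pnorm_pos_of_ne_zero {p : ℝ} (hp1 : 1 < p) (hp2 : p ≤ 2) {A : Finset ℕ} {b : ℕ → ℝ}
    {y : ℝ → ℝ} (hy : y = fun t => ∑ i ∈ A, b i * haarFnP p i t) (hne : y ≠ 0) :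
    0 < pnorm p y := by
  refine (pnorm_nonneg p y).lt_of_ne fun h0 => hne ?_
  have hb := sum_sq_le_pnorm_sq hp1 hp2 b A
  rw [← hy, ← h0] at hb
  have hb0 : 0 ≤ ∑ i ∈ A, b i ^ 2 := Finset.sum_nonneg fun i _ => sq_nonneg _
  have hzero : ∑ i ∈ A, b i ^ 2 = 0 := by nlinarith
  rw [Finset.sum_eq_zero_iff_of_nonneg fun i _ => sq_nonneg _] at hzero
  rw [hy]
  funext t
  exact Finset.sum_eq_zero fun i hi => by simp [pow_eq_zero_iff two_ne_zero |>.1 (hzero i hi)]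

/-- for `1 < p ≤ 2` there is `c = c(p) > 0` such that for every
`m`-element set `A ⊂ ℕ`, every nonzero `y` in the span of `{h_i^{(p)} : i ∈ A}`
and every `i₀ ∈ A` maximizing `|F_y(h_i^{(p)})|`, the DGA greedy step satisfies
`inf_λ ‖y − λ h_{i₀}^{(p)}‖_p ≤ (1 − c·m^{p/(2−2p)})·‖y‖_p`. -/
theorem stmt_14 (p : ℝ) (hp1 : 1 < p) (hp2 : p ≤ 2) :
    ∃ c : ℝ, 0 < c ∧
      ∀ (m : ℕ), 1 ≤ m → ∀ A : Finset ℕ, A.card = m →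
        ∀ (b : ℕ → ℝ) (y : ℝ → ℝ),
          y = (fun t => ∑ i ∈ A, b i * haarFnP p i t) → y ≠ 0 →
          ∀ i₀ ∈ A,
            (∀ i ∈ A, |normingF p y (haarFnP p i)| ≤ |normingF p y (haarFnP p i₀)|) →
            (⨅ lam : ℝ, pnorm p (fun t => y t - lam * haarFnP p i₀ t)) ≤
              (1 - c * (m : ℝ) ^ (p / (2 - 2 * p))) * pnorm p y := by
  have hp0 : 0 < p := by linarith
  have hpm : 0 < p - 1 := by linarith
  refine ⟨(p - 1) / p * 2 * ((p - 1) / 4) ^ (p / (2 * (p - 1))), by positivity, ?_⟩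
  intro m hm A hA b y hy hne i₀ _ hmax
  have hy0 := pnorm_pos_of_ne_zero hp1 hp2 hy hne
  have hym : BoundedMeasurable y := hy ▸ boundedMeasurable_sum_haarFnP p b A
  have hF := sub_one_le_card_mul_sq_of_normingF_le hp1 hp2 hy hy0 hmax
  have hm0 : (0 : ℝ) < m := by exact_mod_cast hm
  set F := |normingF p y (haarFnP p i₀)| with hFdef
  have hF0 : 0 ≤ F := abs_nonneg _
  refine (iInf_pnorm_sub_le hp1 hp2 hym hy0 (boundedMeasurable_haarFnP p i₀)
    (pnorm_haarFnP hp0 i₀)).trans (mul_le_mul_of_nonneg_right ?_ hy0.le)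
  rw [← hFdef]
  have hpow : ((p - 1) / 4) ^ (p / (2 * (p - 1))) * (m : ℝ) ^ (p / (2 - 2 * p)) ≤
      (F / 2) ^ (p / (p - 1)) := by
    have hexp : p / (2 - 2 * p) = -(p / (2 * (p - 1))) := by
      rw [← div_neg]
      congr 1
      ring
    have hsq : (F / 2) ^ (p / (p - 1)) = ((F / 2) ^ 2) ^ (p / (2 * (p - 1))) := by
      rw [← Real.rpow_natCast_mul (by positivity)]
      congr 1
      push_cast
      field_simp
    rw [hexp, Real.rpow_neg hm0.le, ← div_eq_mul_inv, ← Real.div_rpow (by positivity) hm0.le,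
      hsq]
    refine Real.rpow_le_rpow (by positivity) ?_ (by positivity)
    rw [div_le_iff₀ hm0]
    rw [hA] at hF
    nlinarith
  have hcoef : 0 ≤ (p - 1) / p * 2 := by positivity
  have := mul_le_mul_of_nonneg_left hpow hcoef
  linarith
end
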